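/- Let f : [0,∞) → ℝ be operator convex, let p_1,…,p_n be positive real numbers, let L_{ij} (1 ≤ i,j ≤ n) be positive operators on H and R_{ij} (1 ≤ i,j ≤ n) strictly positive operators on H. Set L_i = ∑_{j=1}^n p_j L_{ij} and R_i = ∑_{j=1}^n p_j R_{ij}. Then ∑_{i=1}^n g(L_i,R_i) ≤ ∑_{j=1}^n p_j ∑_{i=1}^n R_{ij}^{1/2} f(R_{ij}^{−1/2} L_{ij} R_{ij}^{−1/2}) R_{ij}^{1/2} in the Loewner order. -/

import Mathlib

open scoped InnerProductSpace

noncomputable section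

/-- A continuous function `f : [0, ∞) → ℝ` is *operator convex* if for every complex Hilbert
space `K`, all selfadjoint operators `A, B` on `K` with spectra in `[0, ∞)` and every
`λ ∈ [0, 1]` one has `f(λA + (1-λ)B) ≤ λ f(A) + (1-λ) f(B)` in the Loewner order, where
`f(A)` is given by the continuous functional calculus. -/
def OperatorConvexOn (f : ℝ → ℝ) : Prop :=
  ∀ (K : Type) [NormedAddCommGroup K] [InnerProductSpace ℂ K] [CompleteSpace K],
    ∀ A B : K →L[ℂ] K, IsSelfAdjoint A → IsSelfAdjoint B →
      spectrum ℝ A ⊆ Set.Ici (0 : ℝ) → spectrum ℝ B ⊆ Set.Ici (0 : ℝ) →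
      ∀ lam : ℝ, lam ∈ Set.Icc (0 : ℝ) 1 →
        cfc f (lam • A + (1 - lam) • B) ≤ lam • cfc f A + (1 - lam) • cfc f B

variable {H : Type} [NormedAddCommGroup H] [InnerProductSpace ℂ H] [CompleteSpace H]

/-- `R^{1/2}` via the continuous functional calculus. -/
def opSqrt (R : H →L[ℂ] H) : H →L[ℂ] H := cfc Real.sqrt R

/-- `R^{-1/2}` via the continuous functional calculus. -/
def opInvSqrt (R : H →L[ℂ] H) : H →L[ℂ] H := cfc (fun t : ℝ => (Real.sqrt t)⁻¹) R

/-- The non-commutative perspective `g(L, R) = R^{1/2} f(R^{-1/2} L R^{-1/2}) R^{1/2}`. -/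
def persp (f : ℝ → ℝ) (L R : H →L[ℂ] H) : H →L[ℂ] H :=
  opSqrt R * cfc f (opInvSqrt R * L * opInvSqrt R) * opSqrt R

open ContinuousLinearMap
open scoped InnerProduct

/-- An intertwiner of two selfadjoint operators also intertwines their images under the continuous
functional calculus. -/
theorem cfc_comp_of_intertwine {E F : Type*} [NormedAddCommGroup E] [InnerProductSpace ℂ E]
    [CompleteSpace E] [NormedAddCommGroup F] [InnerProductSpace ℂ F] [CompleteSpace F]
    {f : ℝ → ℝ} {s : Set ℝ} (hf : ContinuousOn f s) {A : E →L[ℂ] E} {B : F →L[ℂ] F}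
    (hA : IsSelfAdjoint A) (hB : IsSelfAdjoint B) (hAs : spectrum ℝ A ⊆ s)
    (hBs : spectrum ℝ B ⊆ s) {W : E →L[ℂ] F} (hW : B ∘L W = W ∘L A) :
    cfc f B ∘L W = W ∘L cfc f A := by
  have hAt : spectrum ℝ A ⊆ spectrum ℝ A ∪ spectrum ℝ B := Set.subset_union_left
  have hBt : spectrum ℝ B ⊆ spectrum ℝ A ∪ spectrum ℝ B := Set.subset_union_right
  have hts : spectrum ℝ A ∪ spectrum ℝ B ⊆ s := Set.union_subset hAs hBs
  have hcompact : IsCompact (spectrum ℝ A ∪ spectrum ℝ B) :=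
    (spectrum.isCompact (𝕜 := ℝ) A).union (spectrum.isCompact (𝕜 := ℝ) B)
  generalize spectrum ℝ A ∪ spectrum ℝ B = t at hAt hBt hts hcompact
  have : CompactSpace t := isCompact_iff_compactSpace.mp hcompact
  have key (g : C(t, ℝ)) :
      cfcHomSuperset hB hBt g ∘L W = W ∘L cfcHomSuperset hA hAt g := by
    induction g using ContinuousMap.induction_on_of_compact with
    | const r =>
      have hr : ContinuousMap.const t r = algebraMap ℝ C(t, ℝ) r := rfl
      rw [hr, AlgHomClass.commutes, AlgHomClass.commutes, Algebra.algebraMap_eq_smul_one,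
        Algebra.algebraMap_eq_smul_one]
      ext x
      simp
    | id => rwa [cfcHomSuperset_id, cfcHomSuperset_id]
    | star_id => rwa [star_trivial, cfcHomSuperset_id, cfcHomSuperset_id]
    | add g h hg hh => rw [map_add, map_add, add_comp, comp_add, hg, hh]
    | mul g h hg hh =>
      rw [map_mul, map_mul, mul_def, mul_def, comp_assoc, hh, ← comp_assoc, hg, comp_assoc]
    | frequently g hg =>
      refine hg.mem_of_closed (isClosed_eq ?_ ?_)
      · exact (cfcHomSuperset_continuous hB hBt).clm_comp continuous_const
      · exact continuous_const.clm_comp (cfcHomSuperset_continuous hA hAt)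
  have := key ⟨_, (hf.mono hts).domRestrict⟩
  rw [cfc_apply f A hA (hf.mono hAs), cfc_apply f B hB (hf.mono hBs)]
  exact this

/-- The Hansen–Pedersen–Jensen inequality for a single isometry. -/
theorem OperatorConvexOn.cfc_adjoint_conj_le {f : ℝ → ℝ} (hf : OperatorConvexOn f)
    (hf_cont : ContinuousOn f (Set.Ici 0)) {E K : Type} [NormedAddCommGroup E]
    [InnerProductSpace ℂ E] [CompleteSpace E] [NormedAddCommGroup K] [InnerProductSpace ℂ K]
    [CompleteSpace K] {V : E →L[ℂ] K} (hV : V† ∘L V = 1) {T : K →L[ℂ] K} (hT : 0 ≤ T) :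
    cfc f (V† ∘L T ∘L V) ≤ V† ∘L cfc f T ∘L V := by
  have hspec {F : Type} [NormedAddCommGroup F] [InnerProductSpace ℂ F] [CompleteSpace F]
      {S : F →L[ℂ] F} (hS : 0 ≤ S) : spectrum ℝ S ⊆ Set.Ici 0 :=
    fun _ hx ↦ spectrum_nonneg_of_nonneg hS hx
  set J : K →L[ℂ] K := V ∘L V† + V ∘L V† - 1 with hJ
  have hJsa : J† = J := by
    rw [hJ, map_sub, map_add, adjoint_comp, adjoint_adjoint, one_def, adjoint_id]
  have hJV : J ∘L V = V := by
    rw [hJ, sub_comp, add_comp, comp_assoc, hV]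
    ext x
    simp
  have hVJ : V† ∘L J = V† := by
    rw [← hJsa, ← adjoint_comp, hJV]
  have hJJ : J ∘L J = 1 := by
    calc J ∘L J = (V ∘L V† + V ∘L V† - 1) ∘L J := rfl
      _ = V ∘L V† + V ∘L V† - J := by
        rw [sub_comp, add_comp, comp_assoc, hVJ, ← mul_def, one_mul]
      _ = 1 := by rw [hJ, sub_sub_cancel]
  have hS : 0 ≤ J ∘L T ∘L J := by
    have := ((nonneg_iff_isPositive T).mp hT).adjoint_conj J
    rw [hJsa] at this
    exact (nonneg_iff_isPositive _).mpr this
  have hVT : 0 ≤ V† ∘L T ∘L V :=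
    (nonneg_iff_isPositive _).mpr (((nonneg_iff_isPositive T).mp hT).adjoint_conj V)
  set D : K →L[ℂ] K := (1 / 2 : ℝ) • T + (1 - 1 / 2 : ℝ) • (J ∘L T ∘L J) with hD
  have hD0 : 0 ≤ D := add_nonneg (smul_nonneg (by norm_num) hT) (smul_nonneg (by norm_num) hS)
  have hDV : D ∘L V = V ∘L (V† ∘L T ∘L V) := by
    rw [hD, add_comp, smul_comp, smul_comp, comp_assoc, comp_assoc, hJV, hJ]
    ext x
    simp
    module
  have hconv := hf K T (J ∘L T ∘L J) hT.isSelfAdjoint hS.isSelfAdjoint (hspec hT) (hspec hS)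
    (1 / 2) ⟨by norm_num, by norm_num⟩
  have hfD : cfc f D ∘L V = V ∘L cfc f (V† ∘L T ∘L V) :=
    cfc_comp_of_intertwine hf_cont hVT.isSelfAdjoint hD0.isSelfAdjoint (hspec hVT) (hspec hD0) hDV
  have hfS : cfc f (J ∘L T ∘L J) ∘L J = J ∘L cfc f T :=
    cfc_comp_of_intertwine hf_cont hT.isSelfAdjoint hS.isSelfAdjoint (hspec hT) (hspec hS) <| by
      rw [comp_assoc, comp_assoc, hJJ]
      rfl
  have hfSV : V† ∘L cfc f (J ∘L T ∘L J) ∘L V = V† ∘L cfc f T ∘L V := by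
    calc V† ∘L cfc f (J ∘L T ∘L J) ∘L V = V† ∘L (cfc f (J ∘L T ∘L J) ∘L J) ∘L V := by
          rw [comp_assoc, hJV]
      _ = (V† ∘L J) ∘L cfc f T ∘L V := by rw [hfS, comp_assoc, comp_assoc]
      _ = V† ∘L cfc f T ∘L V := by rw [hVJ]
  rw [← hD, ← sub_nonneg, nonneg_iff_isPositive] at hconv
  have hpos := hconv.adjoint_conj V
  rw [← nonneg_iff_isPositive, sub_comp, comp_sub, sub_nonneg, hfD, ← comp_assoc, hV, add_comp,
    comp_add, smul_comp, smul_comp, comp_smul, comp_smul, hfSV, ← add_smul] at hpos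
  rw [← mul_def, one_mul] at hpos
  simpa using hpos

section Column

variable {ι : Type} {E F : Type} [NormedAddCommGroup E] [InnerProductSpace ℂ E]
  [NormedAddCommGroup F] [InnerProductSpace ℂ F]

/-- The column operator `x ↦ (A j x)_j` into the Hilbert sum of copies of `F`. -/
def column (A : ι → E →L[ℂ] F) : E →L[ℂ] PiLp 2 (fun _ : ι ↦ F) :=
  (PiLp.continuousLinearEquiv 2 ℂ (fun _ : ι ↦ F)).symm.toContinuousLinearMap ∘L
    ContinuousLinearMap.pi A

/-- The diagonal operator `(x_j)_j ↦ (X j x_j)_j` on the Hilbert sum of copies of `F`. -/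
def diagonalOp [Fintype ι] (X : ι → F →L[ℂ] F) :
    PiLp 2 (fun _ : ι ↦ F) →L[ℂ] PiLp 2 (fun _ : ι ↦ F) :=
  column fun j ↦ X j ∘L PiLp.proj 2 (fun _ : ι ↦ F) j

@[simp]
theorem column_apply (A : ι → E →L[ℂ] F) (x : E) (j : ι) : column A x j = A j x := rfl

@[simp]
theorem diagonalOp_apply [Fintype ι] (X : ι → F →L[ℂ] F) (x : PiLp 2 (fun _ : ι ↦ F)) (j : ι) :
    diagonalOp X x j = X j (x j) := rfl

theorem adjoint_column_comp_column [Fintype ι] [CompleteSpace E] [CompleteSpace F]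
    (A B : ι → E →L[ℂ] F) :
    (column A)† ∘L column B = ∑ j, (A j)† ∘L B j := by
  ext x
  refine ext_inner_left ℂ fun y ↦ ?_
  simp [adjoint_inner_right, PiLp.inner_apply, sum_apply, inner_sum]

theorem diagonalOp_nonneg [Fintype ι] {X : ι → H →L[ℂ] H} (hX : ∀ j, 0 ≤ X j) : 0 ≤ diagonalOp X := by
  have hX' (j : ι) := (nonneg_iff_isPositive _).mp (hX j)
  rw [nonneg_iff_isPositive, isPositive_def']
  refine ⟨?_, fun x ↦ ?_⟩
  · rw [isSelfAdjoint_iff_isSymmetric]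
    intro x y
    simp only [coe_coe, PiLp.inner_apply, diagonalOp_apply]
    exact Finset.sum_congr rfl fun j _ ↦ (hX' j).isSymmetric _ _
  · rw [reApplyInnerSelf_apply, PiLp.inner_apply, map_sum]
    exact Finset.sum_nonneg fun j _ ↦ (hX' j).re_inner_nonneg_left _

theorem cfc_diagonalOp [Fintype ι] {f : ℝ → ℝ} (hf : ContinuousOn f (Set.Ici 0)) {X : ι → H →L[ℂ] H}
    (hX : ∀ j, 0 ≤ X j) : cfc f (diagonalOp X) = diagonalOp fun j ↦ cfc f (X j) := by
  have hD := diagonalOp_nonneg hX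
  ext x j
  have := cfc_comp_of_intertwine hf hD.isSelfAdjoint (hX j).isSelfAdjoint
    (fun _ h ↦ spectrum_nonneg_of_nonneg hD h) (fun _ h ↦ spectrum_nonneg_of_nonneg (hX j) h)
    (W := PiLp.proj 2 (fun _ : ι ↦ H) j) rfl
  exact congr($this x).symm

/-- The Hansen–Pedersen–Jensen inequality for a finite family. -/
theorem OperatorConvexOn.cfc_sum_adjoint_conj_le [Fintype ι] {f : ℝ → ℝ} (hf : OperatorConvexOn f)
    (hf_cont : ContinuousOn f (Set.Ici 0)) {A X : ι → H →L[ℂ] H}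
    (hA : ∑ j, star (A j) * A j = 1) (hX : ∀ j, 0 ≤ X j) :
    cfc f (∑ j, star (A j) * X j * A j) ≤ ∑ j, star (A j) * cfc f (X j) * A j := by
  have hV : (column A)† ∘L column A = 1 := by
    rw [adjoint_column_comp_column]
    exact hA
  have hsum (Y : ι → H →L[ℂ] H) :
      (column A)† ∘L diagonalOp Y ∘L column A = ∑ j, star (A j) * Y j * A j :=
    adjoint_column_comp_column A fun j ↦ Y j ∘L A j
  have := hf.cfc_adjoint_conj_le hf_cont hV (diagonalOp_nonneg hX)
  rwa [cfc_diagonalOp hf_cont hX, hsum, hsum] at this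

end Column

theorem isSelfAdjoint_opSqrt (R : H →L[ℂ] H) : IsSelfAdjoint (opSqrt R) := cfc_predicate _ _

theorem isSelfAdjoint_opInvSqrt (R : H →L[ℂ] H) : IsSelfAdjoint (opInvSqrt R) :=
  cfc_predicate _ _

theorem opSqrt_mul_self {R : H →L[ℂ] H} (hR : 0 ≤ R) : opSqrt R * opSqrt R = R := by
  rw [opSqrt, ← cfc_mul _ _ R]
  conv_rhs => rw [← cfc_id ℝ R hR.isSelfAdjoint]
  exact cfc_congr fun x hx ↦ Real.mul_self_sqrt (spectrum_nonneg_of_nonneg hR hx)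

theorem spectrum_pos_of_isUnit {R : H →L[ℂ] H} (hR : 0 ≤ R) (hu : IsUnit R) {x : ℝ}
    (hx : x ∈ spectrum ℝ R) : 0 < x :=
  (spectrum_nonneg_of_nonneg hR hx).lt_of_ne' fun h ↦ spectrum.zero_notMem ℝ hu (h ▸ hx)

theorem opSqrt_mul_opInvSqrt {R : H →L[ℂ] H} (hR : 0 ≤ R) (hu : IsUnit R) :
    opSqrt R * opInvSqrt R = 1 := by
  have hne (x : ℝ) (hx : x ∈ spectrum ℝ R) : √x ≠ 0 :=
    (Real.sqrt_pos.mpr (spectrum_pos_of_isUnit hR hu hx)).ne'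
  rw [opSqrt, opInvSqrt, ← cfc_mul _ _ R (by fun_prop) (by fun_prop (disch := assumption)),
    ← cfc_one ℝ R hR.isSelfAdjoint]
  exact cfc_congr fun x hx ↦ mul_inv_cancel₀ (hne x hx)

theorem opInvSqrt_mul_opSqrt {R : H →L[ℂ] H} (hR : 0 ≤ R) (hu : IsUnit R) :
    opInvSqrt R * opSqrt R = 1 := by
  have := congr(star $(opSqrt_mul_opInvSqrt hR hu))
  rwa [star_mul, (isSelfAdjoint_opSqrt R).star_eq, (isSelfAdjoint_opInvSqrt R).star_eq,
    star_one] at this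

/-- The perspective of an operator convex function is jointly subadditive with positive weights. -/
theorem OperatorConvexOn.persp_sum_le {f : ℝ → ℝ} (hf : OperatorConvexOn f)
    (hf_cont : ContinuousOn f (Set.Ici 0)) {ι : Type} [Fintype ι] [Nonempty ι] {p : ι → ℝ}
    (hp : ∀ j, 0 < p j) {L R : ι → H →L[ℂ] H} (hL : ∀ j, 0 ≤ L j) (hR : ∀ j, 0 ≤ R j)
    (hu : ∀ j, IsUnit (R j)) :
    persp f (∑ j, p j • L j) (∑ j, p j • R j) ≤ ∑ j, p j • persp f (L j) (R j) := by
  set S := ∑ j, p j • R j with hS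
  have hS0 : 0 ≤ S := Finset.sum_nonneg fun j _ ↦ smul_nonneg (hp j).le (hR j)
  have hSu : IsUnit S := by
    obtain ⟨j⟩ := ‹Nonempty ι›
    have hj : IsStrictlyPositive (p j • R j) :=
      IsStrictlyPositive.iff_of_unital.mpr
        ⟨smul_nonneg (hp j).le (hR j), (hu j).smul (Units.mk0 (p j) (hp j).ne')⟩
    exact (hj.of_le (Finset.single_le_sum (fun k _ ↦ smul_nonneg (hp k).le (hR k))
      (Finset.mem_univ j))).isUnit
  have hs := isSelfAdjoint_opSqrt (H := H)
  have hi := isSelfAdjoint_opInvSqrt (H := H)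
  set Q := opInvSqrt S with hQ
  set A : ι → H →L[ℂ] H := fun j ↦ √(p j) • (opSqrt (R j) * Q) with hA
  set X : ι → H →L[ℂ] H := fun j ↦ opInvSqrt (R j) * L j * opInvSqrt (R j) with hX
  have hconj (j : ι) (Y : H →L[ℂ] H) :
      star (A j) * Y * A j = Q * (p j • (opSqrt (R j) * Y * opSqrt (R j))) * Q := by
    simp only [hA, star_smul, star_mul, (hs _).star_eq, (hi S).star_eq, hQ, star_trivial,
      smul_mul_assoc, mul_smul_comm, smul_smul, Real.mul_self_sqrt (hp j).le, mul_assoc]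
  have hX0 (j : ι) : 0 ≤ X j := (hi _).conjugate_nonneg (hL j)
  have hA1 : ∑ j, star (A j) * A j = 1 := by
    have h (j : ι) : star (A j) * A j = Q * (p j • R j) * Q := by
      simpa [opSqrt_mul_self (hR j)] using hconj j 1
    simp only [h, ← Finset.sum_mul, ← Finset.mul_sum, ← hS]
    calc Q * S * Q = (Q * opSqrt S) * (opSqrt S * Q) := by
          conv_lhs => rw [← opSqrt_mul_self hS0]
          simp only [mul_assoc]
      _ = 1 := by rw [hQ, opInvSqrt_mul_opSqrt hS0 hSu, opSqrt_mul_opInvSqrt hS0 hSu, one_mul]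
  have hAX : ∑ j, star (A j) * X j * A j = Q * (∑ j, p j • L j) * Q := by
    have h (j : ι) : opSqrt (R j) * X j * opSqrt (R j) = L j := by
      calc opSqrt (R j) * X j * opSqrt (R j)
          = (opSqrt (R j) * opInvSqrt (R j)) * L j * (opInvSqrt (R j) * opSqrt (R j)) := by
            simp only [hX, mul_assoc]
        _ = L j := by
            rw [opInvSqrt_mul_opSqrt (hR j) (hu j), opSqrt_mul_opInvSqrt (hR j) (hu j), one_mul,
              mul_one]
    simp only [hconj, h, ← Finset.sum_mul, ← Finset.mul_sum]
  have hjensen := hf.cfc_sum_adjoint_conj_le hf_cont hA1 hX0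
  rw [hAX] at hjensen
  simp only [hconj, ← Finset.sum_mul, ← Finset.mul_sum] at hjensen
  refine ((hs S).conjugate_le_conjugate hjensen).trans_eq ?_
  calc opSqrt S * (Q * (∑ j, p j • persp f (L j) (R j)) * Q) * opSqrt S
      = (opSqrt S * Q) * (∑ j, p j • persp f (L j) (R j)) * (Q * opSqrt S) := by
        simp only [mul_assoc]
    _ = _ := by
        rw [hQ, opInvSqrt_mul_opSqrt hS0 hSu, opSqrt_mul_opInvSqrt hS0 hSu, one_mul, mul_one]

/-- With `L_i = ∑ j, p j • L i j` and `R_i = ∑ j, p j • R i j`: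
`∑ i, g(L_i, R_i) ≤ ∑ j, p j • ∑ i, g(L i j, R i j)`. -/
theorem stmt_4 (f : ℝ → ℝ) (hf_cont : ContinuousOn f (Set.Ici (0 : ℝ)))
    (hf : OperatorConvexOn f) (n : ℕ)
    (p : Fin n → ℝ) (hp : ∀ j, 0 < p j)
    (L R : Fin n → Fin n → H →L[ℂ] H)
    (hL : ∀ i j, 0 ≤ L i j) (hR : ∀ i j, 0 ≤ R i j ∧ IsUnit (R i j)) :
    (∑ i, persp f (∑ j, p j • L i j) (∑ j, p j • R i j)) ≤
      ∑ j, p j • ∑ i, persp f (L i j) (R i j) := by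
  simp only [Finset.smul_sum]
  rw [Finset.sum_comm]
  refine Finset.sum_le_sum fun i _ ↦ ?_
  have : Nonempty (Fin n) := ⟨i⟩
  exact hf.persp_sum_le hf_cont hp (hL i) (fun j ↦ (hR i j).1) fun j ↦ (hR i j).2
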